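/- arXiv:2008.04566 — 2 statements merged into one kernel-verified Lean document; each statement's English description precedes it below -/
import Mathlib

section
/- Let α ∈ ℝ^{e×d} (e ≥ d ≥ 1) be a non-degenerate coefficient matrix and O the associated optimization map. For constraint matrices m and m' with P^α_m ≠ ∅ and P^α_{m'} ≠ ∅: (i) P^α_m ⊆ P^α_{m'} if and only if O(m) ⊂ m'; (ii) P^α_m = P^α_{m'} if and only if O(m) = O(m'). -/
open Set

/-- A constraint matrix: a pair of vectors of lower and upper bounds in `ℝ^e`. -/
abbrev CM (e : ℕ) := (Fin e → ℝ) × (Fin e → ℝ)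

/-- The open polytope `P^α_m` associated with a coefficient matrix `α` and a
constraint matrix `m`. -/
def PolySet {e d : ℕ} (α : Matrix (Fin e) (Fin d) ℝ) (m : CM e) : Set (Fin d → ℝ) :=
  {x | ∀ i, m.1 i < α.mulVec x i ∧ α.mulVec x i < m.2 i}

/-- A coefficient matrix is non-degenerate if its rows are nonzero and
pairwise non-proportional. -/
def Nondeg {e d : ℕ} (α : Matrix (Fin e) (Fin d) ℝ) : Prop :=
  (∀ i, α i ≠ 0) ∧ ∀ i j : Fin e, i ≠ j → ∀ c : ℝ, α i ≠ c • α j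

/-- The set `Λ_i`: vectors `λ ∈ ℝ^e` supported on some `S` with `|S| ≤ d` which are
the unique solution of `λᵀ α = α_i` with support in `S`. -/
def Lambda {e d : ℕ} (α : Matrix (Fin e) (Fin d) ℝ) (i : Fin e) : Set (Fin e → ℝ) :=
  {l | ∃ S : Finset (Fin e), S.card ≤ d ∧ (∀ k ∉ S, l k = 0) ∧
        (∀ j, ∑ k, l k * α k j = α i j) ∧
        ∀ l' : Fin e → ℝ, (∀ k ∉ S, l' k = 0) → (∀ j, ∑ k, l' k * α k j = α i j) → l' = l}

/-- `e̲_k(a,m)` -/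
noncomputable def eLow {e : ℕ} (a : ℝ) (m : CM e) (k : Fin e) : ℝ :=
  if 0 ≤ a then m.1 k else m.2 k

/-- `ē_k(a,m)` -/
noncomputable def eHigh {e : ℕ} (a : ℝ) (m : CM e) (k : Fin e) : ℝ :=
  if 0 ≤ a then m.2 k else m.1 k

/-- The optimized constraint matrix `O(m)`. -/
noncomputable def Opt {e d : ℕ} (α : Matrix (Fin e) (Fin d) ℝ) (m : CM e) : CM e :=
  (fun i => sSup ((fun l : Fin e → ℝ => ∑ k, l k * eLow (l k) m k) '' Lambda α i),
   fun i => sInf ((fun l : Fin e → ℝ => ∑ k, l k * eHigh (l k) m k) '' Lambda α i))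

/-- Intersection constraint matrix `m ∩ m'`. -/
def interCM {e : ℕ} (m m' : CM e) : CM e :=
  (fun i => max (m.1 i) (m'.1 i), fun i => min (m.2 i) (m'.2 i))

/-- Constraint-matrix inclusion `m ⊂ m'`. -/
def cmSub {e : ℕ} (m m' : CM e) : Prop := ∀ i, m'.1 i ≤ m.1 i ∧ m.2 i ≤ m'.2 i

theorem aux_swap {e d : ℕ} (α : Matrix (Fin e) (Fin d) ℝ) (l : Fin e → ℝ) (x v : Fin d → ℝ)
    (h : ∀ j, ∑ k, l k * α k j = v j) : ∑ k, l k * α.mulVec x k = v ⬝ᵥ x := by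
  have h1 : Matrix.vecMul l α = v := by
    funext j
    rw [← h j]; rfl
  rw [← h1, ← Matrix.dotProduct_mulVec]; rfl

theorem aux_term {e : ℕ} (m : CM e) (y : Fin e → ℝ) (hy : ∀ k, m.1 k < y k ∧ y k < m.2 k)
    (a : ℝ) (k : Fin e) : a * y k ≤ a * eHigh a m k ∧ (a ≠ 0 → a * y k < a * eHigh a m k) := by
  unfold eHigh
  obtain ⟨h1, h2⟩ := hy k
  split_ifs with h
  · refine ⟨mul_le_mul_of_nonneg_left h2.le h, fun h0 => ?_⟩
    exact mul_lt_mul_of_pos_left h2 (lt_of_le_of_ne h (Ne.symm h0))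
  · push Not at h
    have := mul_lt_mul_of_neg_left h1 h
    exact ⟨this.le, fun _ => this⟩

theorem aux_weak {e d : ℕ} (α : Matrix (Fin e) (Fin d) ℝ) (hα : Nondeg α) (m : CM e)
    (x : Fin d → ℝ) (hx : x ∈ PolySet α m) (i : Fin e) (l : Fin e → ℝ)
    (hl : ∀ j, ∑ k, l k * α k j = α i j) :
    α.mulVec x i < ∑ k, l k * eHigh (l k) m k := by
  have h1 : α.mulVec x i = ∑ k, l k * α.mulVec x k := (aux_swap α l x (α i) hl).symm
  rw [h1]
  have hne : ∃ k, l k ≠ 0 := by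
    by_contra hc
    push Not at hc
    apply hα.1 i
    funext j
    rw [← hl j]
    simp [hc]
  obtain ⟨k, hk⟩ := hne
  exact Finset.sum_lt_sum (fun k _ => (aux_term m _ hx (l k) k).1)
    ⟨k, Finset.mem_univ _, (aux_term m _ hx (l k) k).2 hk⟩

theorem aux_prop {d : ℕ} (v w : Fin d → ℝ) (hw : w ≠ 0) (c u : ℝ)
    (h : ∀ x : Fin d → ℝ, c ≤ w ⬝ᵥ x → u ≤ v ⬝ᵥ x) :
    ∃ t : ℝ, 0 ≤ t ∧ v = t • w ∧ u ≤ t * c := by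
  have hww : 0 < w ⬝ᵥ w := by
    have h0 : 0 ≤ w ⬝ᵥ w := Finset.sum_nonneg fun i _ => mul_self_nonneg (w i)
    refine lt_of_le_of_ne h0 fun h => hw ?_
    exact dotProduct_self_eq_zero.1 h.symm
  have key : ∀ (z : Fin d → ℝ), 0 ≤ w ⬝ᵥ z → 0 ≤ v ⬝ᵥ z := by
    intro z hz
    by_contra hc
    push Not at hc
    set x1 := (c / (w ⬝ᵥ w)) • w with hx1
    have hx1w : w ⬝ᵥ x1 = c := by
      rw [hx1, dotProduct_smul, smul_eq_mul]; field_simp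
    have hub := h x1 hx1w.ge
    clear_value x1
    set s := (v ⬝ᵥ x1 - u + 1) / (-(v ⬝ᵥ z)) with hs
    have hs0 : 0 ≤ s := div_nonneg (by linarith) (by linarith)
    have := h (x1 + s • z) (by
      rw [dotProduct_add, dotProduct_smul, hx1w, smul_eq_mul]
      nlinarith [mul_nonneg hs0 hz])
    rw [dotProduct_add, dotProduct_smul, smul_eq_mul] at this
    have h2 : s * (v ⬝ᵥ z) = -(v ⬝ᵥ x1 - u + 1) := by
      rw [hs]; field_simp [hc.ne]
    linarith
  refine ⟨(v ⬝ᵥ w) / (w ⬝ᵥ w), div_nonneg (key w hww.le) hww.le, ?_, ?_⟩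
  · set t := (v ⬝ᵥ w) / (w ⬝ᵥ w) with ht
    have htw : t * (w ⬝ᵥ w) = v ⬝ᵥ w := by rw [ht]; field_simp
    have hz0 : w ⬝ᵥ (v - t • w) = 0 := by
      rw [dotProduct_sub, dotProduct_smul, smul_eq_mul, htw, dotProduct_comm]; ring
    have h1 := key (v - t • w) hz0.ge
    have h2 := key (-(v - t • w)) (by rw [dotProduct_neg, hz0]; simp)
    rw [dotProduct_neg] at h2
    have h3 : (v - t • w) ⬝ᵥ (v - t • w) = 0 := by
      conv_lhs => rw [sub_dotProduct, smul_dotProduct, hz0]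
      rw [smul_zero]; linarith
    have := dotProduct_self_eq_zero.1 h3
    exact sub_eq_zero.1 this
  · have := h ((c / (w ⬝ᵥ w)) • w) (by
      rw [dotProduct_smul, smul_eq_mul]; apply le_of_eq; field_simp)
    rw [dotProduct_smul, smul_eq_mul] at this
    calc u ≤ _ := this
      _ = _ := by ring

theorem aux_strong {e d : ℕ} (α : Matrix (Fin e) (Fin d) ℝ) (hα : Nondeg α) (m : CM e)
    (hm : (PolySet α m).Nonempty) (i : Fin e) (c : ℝ)
    (hc : ∀ x ∈ PolySet α m, α.mulVec x i < c) :
    ∃ l : Fin e → ℝ, (∀ j, ∑ k, l k * α k j = α i j) ∧ ∑ k, l k * eHigh (l k) m k ≤ c := by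
  obtain ⟨x0, hx0⟩ := hm
  let B : Set (Fin e → ℝ) := Set.univ.pi fun k => Set.Ioo (m.1 k) (m.2 k)
  let T : Set (Fin e → ℝ) := {y | ∃ x, y = α.mulVec x ∧ c ≤ α.mulVec x i}
  have hB : Convex ℝ B := convex_pi fun k _ => convex_Ioo _ _
  have hBo : IsOpen B := isOpen_set_pi Set.finite_univ fun k _ => isOpen_Ioo
  have hT : Convex ℝ T := by
    rintro _ ⟨x, rfl, hx⟩ _ ⟨y, rfl, hy⟩ a b ha hb hab
    have he : a • α.mulVec x + b • α.mulVec y = α.mulVec (a • x + b • y) := by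
      rw [Matrix.mulVec_add, Matrix.mulVec_smul, Matrix.mulVec_smul]
    refine ⟨a • x + b • y, he, ?_⟩
    rw [← he]
    simp only [Pi.add_apply, Pi.smul_apply, smul_eq_mul]
    calc c = a * c + b * c := by rw [← add_mul, hab, one_mul]
      _ ≤ _ := by gcongr
  have hd : Disjoint B T := by
    rw [Set.disjoint_left]
    rintro _ hy ⟨x, rfl, hx⟩
    have : x ∈ PolySet α m := fun k => hy k (Set.mem_univ k)
    exact absurd (hc x this) (not_lt.2 hx)
  obtain ⟨g, u, hgB, hgT⟩ := geometric_hahn_banach_open hB hBo hT hd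
  let γ : Fin e → ℝ := fun k => g (Pi.single k 1)
  have hg : ∀ y, g y = ∑ k, γ k * y k := by
    intro y
    conv_lhs => rw [pi_eq_sum_univ' y]
    rw [map_sum]
    refine Finset.sum_congr rfl fun k _ => ?_
    rw [map_smul, smul_eq_mul, mul_comm]
  let v : Fin d → ℝ := fun j => ∑ k, γ k * α k j
  have hgv : ∀ x, g (α.mulVec x) = v ⬝ᵥ x := fun x => by
    rw [hg]; exact aux_swap α γ x v fun j => rfl
  obtain ⟨t, ht0, hvt, hut⟩ := aux_prop v (α i) (hα.1 i) c u (by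
    intro x hx
    rw [← hgv]
    exact hgT _ ⟨x, rfl, hx⟩)
  have hx0B : α.mulVec x0 ∈ B := fun k _ => hx0 k
  have htpos : 0 < t := by
    refine lt_of_le_of_ne ht0 fun h => ?_
    have h1 := hgB _ hx0B
    rw [hgv, hvt, ← h] at h1
    rw [← h] at hut
    simp at h1 hut
    linarith
  have hcorner : ∑ k, γ k * eHigh (γ k) m k ≤ u := by
    let z : Fin e → ℝ := fun k => eHigh (γ k) m k
    have hz : ∀ s : ℝ, 0 ≤ s → s < 1 → g (α.mulVec x0 + s • (z - α.mulVec x0)) < u := by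
      intro s hs0 hs1
      apply hgB
      intro k _
      obtain ⟨h1, h2⟩ := hx0 k
      simp only [Pi.add_apply, Pi.smul_apply, Pi.sub_apply, smul_eq_mul, z, eHigh, Set.mem_Ioo]
      split_ifs
      · constructor <;> nlinarith
      · constructor <;> nlinarith
    rw [← hg z]
    by_contra hcon
    push Not at hcon
    have h0 := hgB _ hx0B
    set a := g (α.mulVec x0) with ha
    have hs1 : (u - a) / (g z - a) < 1 := by
      rw [div_lt_one (by linarith)]; linarith
    have := hz ((u - a) / (g z - a)) (div_nonneg (by linarith) (by linarith)) hs1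
    rw [map_add, map_smul, map_sub, ← ha, smul_eq_mul, div_mul_cancel₀ _ (by linarith)] at this
    linarith
  refine ⟨fun k => t⁻¹ * γ k, ?_, ?_⟩
  · intro j
    have := congrFun hvt j
    simp only [v, Pi.smul_apply, smul_eq_mul] at this
    simp only [mul_assoc]
    rw [← Finset.mul_sum, this, inv_mul_cancel_left₀ htpos.ne']
  · have h1 : ∀ k, t⁻¹ * γ k * eHigh (t⁻¹ * γ k) m k = t⁻¹ * (γ k * eHigh (γ k) m k) := by
      intro k
      have : eHigh (t⁻¹ * γ k) m k = eHigh (γ k) m k := by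
        unfold eHigh
        simp only [mul_nonneg_iff_of_pos_left (inv_pos.2 htpos)]
      rw [this, mul_assoc]
    simp only [h1]
    rw [← Finset.mul_sum, inv_mul_le_iff₀ htpos]
    exact hcorner.trans hut

theorem aux_step {e d : ℕ} (α : Matrix (Fin e) (Fin d) ℝ) (m : CM e)
    (x0 : Fin d → ℝ) (hx0 : x0 ∈ PolySet α m) (L μ : Fin e → ℝ) (hμ0 : μ ≠ 0)
    (hμS : ∀ k, L k = 0 → μ k = 0) (hμ : ∀ j, ∑ k, μ k * α k j = 0)
    (hs : ∑ k, μ k * eHigh (L k) m k ≤ 0) :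
    ∃ t : ℝ, ∑ k, (L k + t * μ k) * eHigh (L k + t * μ k) m k ≤ ∑ k, L k * eHigh (L k) m k ∧
      ∃ k, L k ≠ 0 ∧ L k + t * μ k = 0 := by
  have hex : ∃ k, μ k * L k < 0 := by
    by_contra hc
    push Not at hc
    have h0 : ∑ k, μ k * α.mulVec x0 k = 0 := by
      rw [aux_swap α μ x0 0 (by simpa using hμ)]; simp
    obtain ⟨k0, hk0⟩ := Function.ne_iff.1 hμ0
    have hle : ∀ k, μ k * α.mulVec x0 k ≤ μ k * eHigh (L k) m k ∧
        (μ k ≠ 0 → μ k * α.mulVec x0 k < μ k * eHigh (L k) m k) := by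
      intro k
      by_cases hk : μ k = 0
      · simp [hk]
      · have hL : L k ≠ 0 := fun h => hk (hμS k h)
        have hpos : 0 < μ k * L k := lt_of_le_of_ne (hc k) (mul_ne_zero hk hL).symm
        have : eHigh (L k) m k = eHigh (μ k) m k := by
          unfold eHigh
          rcases pos_and_pos_or_neg_and_neg_of_mul_pos hpos with ⟨h1, h2⟩ | ⟨h1, h2⟩
          · rw [if_pos h1.le, if_pos h2.le]
          · rw [if_neg h1.not_ge, if_neg h2.not_ge]
        rw [this]
        exact aux_term m _ hx0 (μ k) k
    have := Finset.sum_lt_sum (s := Finset.univ) (fun k _ => (hle k).1)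
      ⟨k0, Finset.mem_univ _, (hle k0).2 hk0⟩
    linarith
  have hne : (Finset.univ.filter fun k => μ k * L k < 0).Nonempty := by
    obtain ⟨k, hk⟩ := hex
    exact ⟨k, by simpa using hk⟩
  obtain ⟨k0, hk0, hmin⟩ := Finset.exists_min_image _ (fun k => - L k / μ k) hne
  simp only [Finset.mem_filter, Finset.mem_univ, true_and] at hk0 hmin
  have hμk0 : μ k0 ≠ 0 := fun h => by simp [h] at hk0
  have hLk0 : L k0 ≠ 0 := fun h => by simp [h] at hk0
  set t := - L k0 / μ k0 with ht
  have htm : t * μ k0 = - L k0 := by rw [ht]; field_simp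
  have ht0 : 0 ≤ t := by
    have : 0 < t * (μ k0 * μ k0) := by
      rw [← mul_assoc, htm]; linarith
    exact (pos_of_mul_pos_left this (mul_self_nonneg _)).le
  refine ⟨t, ?_, k0, hLk0, by rw [htm]; ring⟩
  have hterm : ∀ k, (L k + t * μ k) * eHigh (L k + t * μ k) m k
      = L k * eHigh (L k) m k + t * (μ k * eHigh (L k) m k) := by
    intro k
    have hsg : (0 ≤ L k → 0 ≤ L k + t * μ k) ∧ (L k < 0 → L k + t * μ k ≤ 0) := by
      constructor
      · intro h
        by_cases hk : 0 ≤ μ k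
        · have := mul_nonneg ht0 hk
          linarith
        · push Not at hk
          rcases h.eq_or_lt with h | h
          · exact absurd (hμS k h.symm) hk.ne
          · have := hmin k (mul_neg_of_neg_of_pos hk h)
            rw [le_div_iff_of_neg hk] at this
            linarith
      · intro h
        by_cases hk : μ k ≤ 0
        · have := mul_nonpos_of_nonneg_of_nonpos ht0 hk
          linarith
        · push Not at hk
          have := hmin k (mul_neg_of_pos_of_neg hk h)
          rw [le_div_iff₀ hk] at this
          linarith
    have : (L k + t * μ k) * eHigh (L k + t * μ k) m k = (L k + t * μ k) * eHigh (L k) m k := by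
      by_cases hz : L k + t * μ k = 0
      · rw [hz]; ring
      congr 1
      unfold eHigh
      by_cases h : 0 ≤ L k
      · rw [if_pos h, if_pos (hsg.1 h)]
      · have h' := hsg.2 (not_le.1 h)
        rw [if_neg h, if_neg (not_le.2 (lt_of_le_of_ne h' hz))]
    rw [this]; ring
  simp only [hterm]
  rw [Finset.sum_add_distrib, ← Finset.mul_sum]
  have := mul_nonpos_of_nonneg_of_nonpos ht0 hs
  linarith

theorem aux_reduce {e d : ℕ} (α : Matrix (Fin e) (Fin d) ℝ) (m : CM e)
    (hm : (PolySet α m).Nonempty) (i : Fin e) (c : ℝ) (n : ℕ) : ∀ L : Fin e → ℝ,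
    (Finset.univ.filter fun k => L k ≠ 0).card = n →
    (∀ j, ∑ k, L k * α k j = α i j) → ∑ k, L k * eHigh (L k) m k ≤ c →
    ∃ l ∈ Lambda α i, ∑ k, l k * eHigh (l k) m k ≤ c := by
  obtain ⟨x0, hx0⟩ := hm
  induction n using Nat.strong_induction_on with
  | _ n ih =>
  intro L hn hL hc
  by_cases hrel : ∃ μ : Fin e → ℝ, μ ≠ 0 ∧ (∀ k, L k = 0 → μ k = 0) ∧
      ∀ j, ∑ k, μ k * α k j = 0
  · have : ∃ μ : Fin e → ℝ, μ ≠ 0 ∧ (∀ k, L k = 0 → μ k = 0) ∧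
        (∀ j, ∑ k, μ k * α k j = 0) ∧ ∑ k, μ k * eHigh (L k) m k ≤ 0 := by
      obtain ⟨μ, h0, h1, h2⟩ := hrel
      rcases le_total (∑ k, μ k * eHigh (L k) m k) 0 with h | h
      · exact ⟨μ, h0, h1, h2, h⟩
      · refine ⟨-μ, neg_ne_zero.2 h0, fun k hk => by simp [h1 k hk], fun j => ?_, ?_⟩
        · simp [h2 j]
        · simpa using h
    obtain ⟨μ, h0, h1, h2, h3⟩ := this
    obtain ⟨t, ht, k0, hk0, hk0'⟩ := aux_step α m x0 hx0 L μ h0 h1 h2 h3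
    refine ih _ ?_ (fun k => L k + t * μ k) rfl ?_ (ht.trans hc)
    · rw [← hn]
      apply Finset.card_lt_card
      rw [Finset.ssubset_iff_of_subset]
      · exact ⟨k0, by simpa using hk0, by simpa using hk0'⟩
      · intro k hk
        simp only [Finset.mem_filter, Finset.mem_univ, true_and] at hk ⊢
        intro h
        apply hk
        simp [h, h1 k h]
    · intro j
      simp only [add_mul, mul_assoc]
      rw [Finset.sum_add_distrib, ← Finset.mul_sum, h2 j, hL j]; ring
  · push Not at hrel
    have huniq : ∀ μ : Fin e → ℝ, (∀ k, L k = 0 → μ k = 0) →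
        (∀ j, ∑ k, μ k * α k j = 0) → μ = 0 := by
      intro μ h1 h2
      by_contra h0
      obtain ⟨j, hj⟩ := hrel μ h0 h1
      exact hj (h2 j)
    refine ⟨L, ⟨Finset.univ.filter fun k => L k ≠ 0, ?_, ?_, hL, ?_⟩, hc⟩
    · have hli : LinearIndependent ℝ
          (fun k : {k // k ∈ Finset.univ.filter fun k => L k ≠ 0} => α k) := by
        rw [Fintype.linearIndependent_iff]
        intro g hg k
        let μ : Fin e → ℝ := fun k =>
          if h : k ∈ Finset.univ.filter (fun k => L k ≠ 0) then g ⟨k, h⟩ else 0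
        have : μ = 0 := by
          apply huniq
          · intro k hk
            simp [μ, hk]
          · intro j
            have h1 := congrFun hg j
            simp only [Finset.sum_apply, Pi.smul_apply, smul_eq_mul, Pi.zero_apply] at h1
            rw [← h1]
            have h2 : ∑ k, μ k * α k j
                = ∑ k ∈ Finset.univ.filter (fun k => L k ≠ 0), μ k * α k j := by
              symm
              apply Finset.sum_subset (Finset.subset_univ _)
              intro k _ hk
              simp only [μ, dif_neg hk, zero_mul]
            rw [h2, ← Finset.sum_coe_sort]
            refine Finset.sum_congr rfl fun k _ => ?_
            simp only [μ, dif_pos k.2]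
        have h3 := congrFun this k
        simp only [μ, dif_pos k.2] at h3
        exact h3
      have := hli.fintype_card_le_finrank
      rwa [Fintype.card_coe, Module.finrank_fin_fun] at this
    · intro k hk
      simpa using hk
    · intro l' h1 h2
      have := huniq (l' - L) (by
        intro k hk
        simp [hk, h1 k (by simpa using hk)]) (by
        intro j
        simp only [Pi.sub_apply, sub_mul]
        rw [Finset.sum_sub_distrib, h2 j, hL j, sub_self])
      exact sub_eq_zero.1 this

theorem aux_finite {e d : ℕ} (α : Matrix (Fin e) (Fin d) ℝ) (i : Fin e) :
    (Lambda α i).Finite := by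
  have : Lambda α i = ⋃ S : Finset (Fin e), {l | S.card ≤ d ∧ (∀ k ∉ S, l k = 0) ∧
        (∀ j, ∑ k, l k * α k j = α i j) ∧
        ∀ l' : Fin e → ℝ, (∀ k ∉ S, l' k = 0) → (∀ j, ∑ k, l' k * α k j = α i j) → l' = l} := by
    ext l
    simp [Lambda]
  rw [this]
  refine Set.finite_iUnion fun S => Set.Subsingleton.finite ?_
  rintro l ⟨_, _, _, h⟩ l' ⟨_, h1, h2, _⟩
  exact (h l' h1 h2).symm

theorem aux_single {e d : ℕ} (hd : 1 ≤ d) (α : Matrix (Fin e) (Fin d) ℝ) (hα : Nondeg α)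
    (i : Fin e) : Pi.single i 1 ∈ Lambda α i := by
  refine ⟨{i}, by simpa using hd, ?_, ?_, ?_⟩
  · intro k hk
    simp at hk
    simp [hk]
  · intro j
    simp [Pi.single_apply]
  · intro l' h1 h2
    obtain ⟨j, hj⟩ := Function.ne_iff.1 (hα.1 i)
    have h3 := h2 j
    rw [Finset.sum_eq_single i (fun k _ hk => by rw [h1 k (by simpa using hk), zero_mul])
      (by simp)] at h3
    have h4 : l' i = 1 := mul_right_cancel₀ hj (by rw [h3, one_mul])
    funext k
    by_cases hk : k = i
    · subst hk; simp [h4]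
    · simp [hk, h1 k (by simpa using hk)]

/-- reflected constraint matrix -/
def negCM {e : ℕ} (m : CM e) : CM e := (-m.2, -m.1)

theorem aux_neg_mem {e d : ℕ} (α : Matrix (Fin e) (Fin d) ℝ) (m : CM e) (x : Fin d → ℝ) :
    -x ∈ PolySet α (negCM m) ↔ x ∈ PolySet α m := by
  simp only [PolySet, negCM, Set.mem_ofPred_eq, Matrix.mulVec_neg, Pi.neg_apply, neg_lt_neg_iff]
  exact forall_congr' fun i => and_comm

theorem aux_neg_high {e : ℕ} (m : CM e) (a : ℝ) (k : Fin e) :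
    eHigh a (negCM m) k = - eLow a m k := by
  unfold eHigh eLow negCM
  split_ifs <;> simp

theorem aux_opt_neg {e d : ℕ} (α : Matrix (Fin e) (Fin d) ℝ) (m : CM e) :
    (Opt α m).1 = - (Opt α (negCM m)).2 := by
  funext i
  simp only [Opt, Pi.neg_apply, aux_neg_high]
  rw [Real.sInf_def, neg_neg]
  congr 1
  ext r
  simp [neg_add_eq_zero, eq_neg_iff_add_eq_zero]

theorem aux_high_lt {e d : ℕ} (hd : 1 ≤ d) (α : Matrix (Fin e) (Fin d) ℝ) (hα : Nondeg α)
    (m : CM e) (x : Fin d → ℝ) (hx : x ∈ PolySet α m) (i : Fin e) :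
    α.mulVec x i < (Opt α m).2 i := by
  have hne : (Lambda α i).Nonempty := ⟨_, aux_single hd α hα i⟩
  have := Set.Nonempty.csInf_mem
    (hne.image (fun l : Fin e → ℝ => ∑ k, l k * eHigh (l k) m k))
    ((aux_finite α i).image _)
  obtain ⟨l, ⟨S, _, _, hl, _⟩, hl'⟩ := this
  have h := aux_weak α hα m x hx i l hl
  calc _ < _ := h
    _ = _ := hl'

theorem aux_high_le {e d : ℕ} (α : Matrix (Fin e) (Fin d) ℝ)
    (m : CM e) (i : Fin e) (l : Fin e → ℝ) (hl : l ∈ Lambda α i) :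
    (Opt α m).2 i ≤ ∑ k, l k * eHigh (l k) m k :=
  csInf_le ((aux_finite α i).image _).bddBelow ⟨l, hl, rfl⟩

theorem aux_high_self {e d : ℕ} (hd : 1 ≤ d) (α : Matrix (Fin e) (Fin d) ℝ) (hα : Nondeg α)
    (m : CM e) (i : Fin e) : (Opt α m).2 i ≤ m.2 i := by
  refine (aux_high_le α m i _ (aux_single hd α hα i)).trans (le_of_eq ?_)
  rw [Finset.sum_eq_single i]
  · simp [eHigh]
  · intro k _ hk; simp [hk]
  · simp

theorem aux_high_opt {e d : ℕ} (α : Matrix (Fin e) (Fin d) ℝ) (hα : Nondeg α)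
    (m : CM e) (hm : (PolySet α m).Nonempty) (i : Fin e) (c : ℝ)
    (hc : ∀ x ∈ PolySet α m, α.mulVec x i < c) : (Opt α m).2 i ≤ c := by
  obtain ⟨L, hL, hLc⟩ := aux_strong α hα m hm i c hc
  obtain ⟨l, hl, hlc⟩ := aux_reduce α m hm i c _ L rfl hL hLc
  exact (aux_high_le α m i l hl).trans hlc

theorem aux_opt_poly {e d : ℕ} (hd : 1 ≤ d) (α : Matrix (Fin e) (Fin d) ℝ) (hα : Nondeg α)
    (m : CM e) : PolySet α (Opt α m) = PolySet α m := by
  ext x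
  constructor
  · intro hx i
    obtain ⟨h1, h2⟩ := hx i
    refine ⟨?_, h2.trans_le (aux_high_self hd α hα m i)⟩
    have := aux_high_self hd α hα (negCM m) i
    rw [aux_opt_neg] at h1
    simp only [Pi.neg_apply, negCM] at this h1
    linarith
  · intro hx i
    refine ⟨?_, aux_high_lt hd α hα m x hx i⟩
    have := aux_high_lt hd α hα (negCM m) (-x) ((aux_neg_mem α m x).2 hx) i
    rw [aux_opt_neg]
    simp only [Pi.neg_apply, Matrix.mulVec_neg] at this ⊢
    linarith

theorem aux_one {e d : ℕ} (hd : 1 ≤ d) (α : Matrix (Fin e) (Fin d) ℝ) (hα : Nondeg α)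
    (m m' : CM e) (hm : (PolySet α m).Nonempty) :
    PolySet α m ⊆ PolySet α m' ↔ cmSub (Opt α m) m' := by
  constructor
  · intro h i
    refine ⟨?_, aux_high_opt α hα m hm i _ fun x hx => (h hx i).2⟩
    obtain ⟨x0, hx0⟩ := hm
    have := aux_high_opt α hα (negCM m) ⟨-x0, (aux_neg_mem α m x0).2 hx0⟩ i (-m'.1 i) (by
      intro x hx
      have h1 : -x ∈ PolySet α m := (aux_neg_mem α m (-x)).1 (by simpa using hx)
      have h2 := (h h1 i).1
      simp only [Matrix.mulVec_neg, Pi.neg_apply] at h2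
      linarith)
    rw [aux_opt_neg]
    simp only [Pi.neg_apply]
    linarith
  · intro h x hx i
    rw [← aux_opt_poly hd α hα m] at hx
    exact ⟨(h i).1.trans_lt (hx i).1, (hx i).2.trans_le (h i).2⟩

/-- for nonempty polytopes, inclusion reads `O(m) ⊂ m'` and equality reads
`O(m) = O(m')` on constraint matrices. -/
theorem statement_3 {d e : ℕ} (hd : 1 ≤ d) (hde : d ≤ e)
    (α : Matrix (Fin e) (Fin d) ℝ) (hα : Nondeg α) (m m' : CM e)
    (hm : (PolySet α m).Nonempty) (hm' : (PolySet α m').Nonempty) :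
    (PolySet α m ⊆ PolySet α m' ↔ cmSub (Opt α m) m') ∧
    (PolySet α m = PolySet α m' ↔ Opt α m = Opt α m') := by
  refine ⟨aux_one hd α hα m m' hm, fun h => ?_, fun h => ?_⟩
  · have h1 := (aux_one hd α hα m (Opt α m') hm).1 (by rw [aux_opt_poly hd α hα m', h])
    have h2 := (aux_one hd α hα m' (Opt α m) hm').1 (by rw [aux_opt_poly hd α hα m, h])
    refine Prod.ext (funext fun i => ?_) (funext fun i => ?_)
    · exact le_antisymm (h2 i).1 (h1 i).1
    · exact le_antisymm (h1 i).2 (h2 i).2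
  · rw [← aux_opt_poly hd α hα m, h, aux_opt_poly hd α hα m']
end

section
/- Let α be the canonical 6×3 coefficient matrix with rows e₁, e₂, e₃, e₁+e₂, e₂+e₃, e₁+e₂+e₃. Then for every ε ∈ (0,1/2), there is no constraint matrix m ∈ ℝ^{6×2} such that the polytope P^α_m satisfies all the conditions of Conditioning Problem 4 for G_{3,ε}. -/
open Set

/-- The map `h`. -/
noncomputable def hfun (u : ℝ) : ℝ :=
  if Int.fract (u + 1/2) = 0 then (0:ℝ) else ((⌊u + 1/2⌋ : ℤ) : ℝ)

/-- The open unit cube `(0,1)³`. -/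
def cube3 : Set (Fin 3 → ℝ) := {x | ∀ i, 0 < x i ∧ x i < 1}

/-- The map `G_{3,ε}`. -/
noncomputable def G3 (ε : ℝ) (x : Fin 3 → ℝ) : Fin 3 → ℝ :=
  ![2*(1-ε)*x 0 + 2*ε*((2*hfun (x 0) - hfun (x 1) + hfun (x 0 + x 1) - hfun (x 1 + x 2)
      + hfun (x 0 + x 1 + x 2))/4) - hfun (x 0),
    2*(1-ε)*x 1 + 2*ε*((2*hfun (x 1) - hfun (x 0) - hfun (x 2) + hfun (x 0 + x 1)
      + hfun (x 1 + x 2))/4) - hfun (x 1),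
    2*(1-ε)*x 2 + 2*ε*((2*hfun (x 2) - hfun (x 1) - hfun (x 0 + x 1) + hfun (x 1 + x 2)
      + hfun (x 0 + x 1 + x 2))/4) - hfun (x 2)]

/-- The atom `A_ω` with label `ω = (h(x₁),h(x₂),h(x₃),h(x₁+x₂),h(x₂+x₃),h(x₁+x₂+x₃))`. -/
noncomputable def Atom3 (ω : Fin 6 → ℤ) : Set (Fin 3 → ℝ) :=
  {x | x ∈ cube3 ∧ hfun (x 0) = (ω 0 : ℝ) ∧ hfun (x 1) = (ω 1 : ℝ) ∧ hfun (x 2) = (ω 2 : ℝ) ∧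
       hfun (x 0 + x 1) = (ω 3 : ℝ) ∧ hfun (x 1 + x 2) = (ω 4 : ℝ) ∧
       hfun (x 0 + x 1 + x 2) = (ω 5 : ℝ)}

/-- Componentwise fractional part. -/
noncomputable def frv (v : Fin 3 → ℝ) : Fin 3 → ℝ := fun i => Int.fract (v i)

noncomputable def sigma4231 (x : Fin 3 → ℝ) : Fin 3 → ℝ := frv ![-(x 1) - x 2, x 1, -(x 0) - x 1]
noncomputable def sigma1324 (x : Fin 3 → ℝ) : Fin 3 → ℝ := frv ![x 0 + x 1, -(x 1), x 1 + x 2]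
noncomputable def sigma4321 (x : Fin 3 → ℝ) : Fin 3 → ℝ := frv ![-(x 2), -(x 1), -(x 0)]
noncomputable def sigma2134 (x : Fin 3 → ℝ) : Fin 3 → ℝ := frv ![-(x 0), x 0 + x 1, x 2]
noncomputable def sigma3124 (x : Fin 3 → ℝ) : Fin 3 → ℝ := frv ![-(x 0) - x 1, x 0, x 1 + x 2]

/-- The symmetry `Σ(x) = (1-x₁, 1-x₂, 1-x₃)`. -/
def Sig3 (x : Fin 3 → ℝ) : Fin 3 → ℝ := fun i => 1 - x i

/-- The canonical 6×3 coefficient matrix with rows `e₁,e₂,e₃,e₁+e₂,e₂+e₃,e₁+e₂+e₃`. -/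
def alpha6 : Matrix (Fin 6) (Fin 3) ℝ := !![1,0,0; 0,1,0; 0,0,1; 1,1,0; 0,1,1; 1,1,1]

/-- Conditioning Problem 4 for a set `P`. -/
noncomputable def SolvesCP4 (ε : ℝ) (P : Set (Fin 3 → ℝ)) : Prop :=
  P.Nonempty ∧ P ⊆ cube3 ∧
  (∀ ω : Fin 6 → ℤ, (P ∩ Atom3 ω).Nonempty ↔
    ω = ![0,0,0,0,0,0] ∨ ω = ![0,0,0,0,0,1] ∨ ω = ![0,0,0,1,0,1]) ∧
  G3 ε '' (P ∩ Atom3 ![0,0,0,0,0,0]) ⊆ P ∩ Atom3 ![0,0,0,1,0,1] ∧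
  G3 ε '' (P ∩ Atom3 ![0,0,0,0,0,1]) ⊆ sigma3124 '' P ∧
  G3 ε '' (P ∩ Atom3 ![0,0,0,1,0,1]) ⊆ sigma2134 '' P

def KK (l u : Fin 6 → ℝ) (a b c : ℝ) : Prop :=
  (l 0 < a ∧ a < u 0) ∧ (l 1 < b ∧ b < u 1) ∧ (l 2 < c ∧ c < u 2) ∧
  (l 3 < a + b ∧ a + b < u 3) ∧ (l 4 < b + c ∧ b + c < u 4) ∧
  (l 5 < a + b + c ∧ a + b + c < u 5)

lemma diff_min {l u p q r s : ℝ} (h : l < q - p ∧ q - p < u) (h' : l < s - r ∧ s - r < u) :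
    l < min q s - min p r ∧ min q s - min p r < u := by
  rcases min_cases q s with h1 | h1 <;> rcases min_cases p r with h2 | h2 <;>
    constructor <;> linarith [h1.1, h1.2, h2.1, h2.2, h.1, h.2, h'.1, h'.2]

lemma diff_max {l u p q r s : ℝ} (h : l < q - p ∧ q - p < u) (h' : l < s - r ∧ s - r < u) :
    l < max q s - max p r ∧ max q s - max p r < u := by
  rcases max_cases q s with h1 | h1 <;> rcases max_cases p r with h2 | h2 <;>
    constructor <;> linarith [h1.1, h1.2, h2.1, h2.2, h.1, h.2, h'.1, h'.2]

lemma KK_iff {l u : Fin 6 → ℝ} (y0 y1 y2 y3 : ℝ) : KK l u (y1 - y0) (y2 - y1) (y3 - y2) ↔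
    (l 0 < y1 - y0 ∧ y1 - y0 < u 0) ∧ (l 1 < y2 - y1 ∧ y2 - y1 < u 1) ∧
    (l 2 < y3 - y2 ∧ y3 - y2 < u 2) ∧ (l 3 < y2 - y0 ∧ y2 - y0 < u 3) ∧
    (l 4 < y3 - y1 ∧ y3 - y1 < u 4) ∧ (l 5 < y3 - y0 ∧ y3 - y0 < u 5) := by
  unfold KK
  rw [show y1 - y0 + (y2 - y1) = y2 - y0 by ring, show y2 - y1 + (y3 - y2) = y3 - y1 by ring,
    show y2 - y0 + (y3 - y2) = y3 - y0 by ring]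

lemma KK_min {l u : Fin 6 → ℝ} {y0 y1 y2 y3 z0 z1 z2 z3 : ℝ}
    (h : KK l u (y1 - y0) (y2 - y1) (y3 - y2)) (h' : KK l u (z1 - z0) (z2 - z1) (z3 - z2)) :
    KK l u (min y1 z1 - min y0 z0) (min y2 z2 - min y1 z1) (min y3 z3 - min y2 z2) := by
  rw [KK_iff] at *
  obtain ⟨h0, h1, h2, h3, h4, h5⟩ := h
  obtain ⟨g0, g1, g2, g3, g4, g5⟩ := h'
  exact ⟨diff_min h0 g0, diff_min h1 g1, diff_min h2 g2, diff_min h3 g3, diff_min h4 g4,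
    diff_min h5 g5⟩

lemma KK_max {l u : Fin 6 → ℝ} {y0 y1 y2 y3 z0 z1 z2 z3 : ℝ}
    (h : KK l u (y1 - y0) (y2 - y1) (y3 - y2)) (h' : KK l u (z1 - z0) (z2 - z1) (z3 - z2)) :
    KK l u (max y1 z1 - max y0 z0) (max y2 z2 - max y1 z1) (max y3 z3 - max y2 z2) := by
  rw [KK_iff] at *
  obtain ⟨h0, h1, h2, h3, h4, h5⟩ := h
  obtain ⟨g0, g1, g2, g3, g4, g5⟩ := h'
  exact ⟨diff_max h0 g0, diff_max h1 g1, diff_max h2 g2, diff_max h3 g3, diff_max h4 g4,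
    diff_max h5 g5⟩

lemma KK_base {l u : Fin 6 → ℝ} {a b c : ℝ} (h : KK l u a b c) (r : ℝ) :
    KK l u ((r + a) - r) ((r + a + b) - (r + a)) ((r + a + b + c) - (r + a + b)) := by
  convert h using 1 <;> ring

lemma L0max {l u : Fin 6 → ℝ} {a b c a' b' c' : ℝ} (h : KK l u a b c) (h' : KK l u a' b' c') :
    ∃ x y z, KK l u x y z ∧ a ≤ x ∧ a' ≤ x ∧ a + b ≤ x + y ∧ a' + b' ≤ x + y := by
  refine ⟨_, _, _, KK_max (KK_base h 0) (KK_base h' 0), ?_, ?_, ?_, ?_⟩ <;>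
  simp only [max_self] <;>
  linarith [le_max_left (0 + a) (0 + a'), le_max_right (0 + a) (0 + a'),
    le_max_left (0 + a + b) (0 + a' + b'), le_max_right (0 + a + b) (0 + a' + b')]

lemma L0min {l u : Fin 6 → ℝ} {a b c a' b' c' : ℝ} (h : KK l u a b c) (h' : KK l u a' b' c') :
    ∃ x y z, KK l u x y z ∧ x ≤ a ∧ x + y ≤ a + b ∧ x + y + z ≤ a' + b' + c' := by
  refine ⟨_, _, _, KK_min (KK_base h 0) (KK_base h' 0), ?_, ?_, ?_⟩ <;>
  simp only [min_self] <;>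
  linarith [min_le_left (0 + a) (0 + a'), min_le_right (0 + a) (0 + a'),
    min_le_left (0 + a + b) (0 + a' + b'), min_le_right (0 + a + b + c) (0 + a' + b' + c')]

lemma L1min {l u : Fin 6 → ℝ} {a b c a' b' c' : ℝ} (h : KK l u a b c) (h' : KK l u a' b' c') :
    ∃ x y z, KK l u x y z ∧ a ≤ x ∧ y ≤ b' ∧ y + z ≤ b' + c' := by
  refine ⟨_, _, _, KK_min (KK_base h (-a)) (KK_base h' (-a')), ?_, ?_, ?_⟩ <;>
  simp only [neg_add_cancel, min_self] <;>
  linarith [min_le_left (-a) (-a'), min_le_right (0 + b) (0 + b'),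
    min_le_right (0 + b + c) (0 + b' + c')]

lemma L1max {l u : Fin 6 → ℝ} {a b c a' b' c' : ℝ} (h : KK l u a b c) (h' : KK l u a' b' c') :
    ∃ x y z, KK l u x y z ∧ x ≤ a ∧ b' ≤ y := by
  refine ⟨_, _, _, KK_max (KK_base h (-a)) (KK_base h' (-a')), ?_, ?_⟩ <;>
  simp only [neg_add_cancel, max_self] <;>
  linarith [le_max_left (-a) (-a'), le_max_right (0 + b) (0 + b')]

lemma L2min {l u : Fin 6 → ℝ} {a b c a' b' c' : ℝ} (h : KK l u a b c) (h' : KK l u a' b' c') :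
    ∃ x y z, KK l u x y z ∧ z ≤ c ∧ a' + b' ≤ x + y := by
  refine ⟨_, _, _, KK_min (KK_base h (-a - b)) (KK_base h' (-a' - b')), ?_, ?_⟩ <;>
  simp only [show -a - b + a + b = 0 by ring, show -a' - b' + a' + b' = 0 by ring, min_self] <;>
  linarith [min_le_right (-a - b) (-a' - b'), min_le_left (0 + c) (0 + c')]

lemma L3max {l u : Fin 6 → ℝ} {a b c a' b' c' : ℝ} (h : KK l u a b c) (h' : KK l u a' b' c') :
    ∃ x y z, KK l u x y z ∧ z ≤ c ∧ y + z ≤ b + c ∧ x + y + z ≤ a' + b' + c' := by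
  refine ⟨_, _, _, KK_max (KK_base h (-a - b - c)) (KK_base h' (-a' - b' - c')), ?_, ?_, ?_⟩ <;>
  simp only [show -a - b - c + a + b + c = 0 by ring,
    show -a' - b' - c' + a' + b' + c' = 0 by ring, max_self] <;>
  linarith [le_max_right (-a - b - c) (-a' - b' - c'),
    le_max_left (-a - b - c + a) (-a' - b' - c' + a'),
    le_max_left (-a - b - c + a + b) (-a' - b' - c' + a' + b')]

lemma LN {l u : Fin 6 → ℝ} {xa xb xc ya yb yc va vb vc za zb zc : ℝ}
    (hx : KK l u xa xb xc) (hy : KK l u ya yb yc) (hv : KK l u va vb vc) (hz : KK l u za zb zc)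
    (hs : za + zb + zc < 1/2) (h : xa + vb + yc < 1/2) :
    ∃ x y z, KK l u x y z ∧ vb ≤ y ∧ x + y + z < 1/2 := by
  obtain ⟨wa, wb, wc, hw, hw1, hw2⟩ := L1max hx hv
  obtain ⟨ma, mb, mc, hm, hm1, hm2, hm3⟩ := L3max hy hz
  refine ⟨_, _, _, KK_min (KK_base hm (-ma - mb - mc)) (KK_base hw (-yc - vb - wa)), ?_, ?_⟩
  · have h1 : -yc ≤ min (-ma - mb - mc + ma + mb) (-yc - vb - wa + wa + wb) :=
      le_min (by linarith) (by linarith)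
    linarith [min_le_right (-ma - mb - mc + ma) (-yc - vb - wa + wa)]
  · have h1 : -(1/2) < min (-ma - mb - mc) (-yc - vb - wa) :=
      lt_min (by linarith) (by linarith)
    linarith [min_le_left (-ma - mb - mc + ma + mb + mc) (-yc - vb - wa + wa + wb + wc)]

lemma cvx_lt {l x y t : ℝ} (h : l < x) (h' : l < y) (h0 : 0 ≤ t) (h1 : t ≤ 1) :
    l < (1 - t) * x + t * y := by
  rcases eq_or_lt_of_le h0 with h2 | h2
  · subst h2; linarith
  · nlinarith [mul_pos h2 (sub_pos.2 h'), mul_nonneg (sub_nonneg.2 h1) (sub_pos.2 h).le]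

lemma cvx_gt {l x y t : ℝ} (h : x < l) (h' : y < l) (h0 : 0 ≤ t) (h1 : t ≤ 1) :
    (1 - t) * x + t * y < l := by
  have := cvx_lt (neg_lt_neg h) (neg_lt_neg h') h0 h1
  linarith

lemma seg_hit {l u : Fin 6 → ℝ} {a b c a' b' c' : ℝ} (h : KK l u a b c) (h' : KK l u a' b' c')
    (A B C τ : ℝ) (h1 : A * a + B * b + C * c < τ) (h2 : τ ≤ A * a' + B * b' + C * c') :
    ∃ x y z, KK l u x y z ∧ A * x + B * y + C * z = τ ∧
      ∀ A B C k : ℝ, A * a + B * b + C * c ≤ k → A * a' + B * b' + C * c' ≤ k →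
        A * x + B * y + C * z ≤ k := by
  set f := A * a + B * b + C * c with hf
  set f' := A * a' + B * b' + C * c' with hf'
  have hd : 0 < f' - f := by linarith
  obtain ⟨t, ht⟩ : ∃ t, t = (τ - f) / (f' - f) := ⟨_, rfl⟩
  have t0 : 0 ≤ t := by rw [ht]; apply div_nonneg <;> linarith
  have t1 : t ≤ 1 := by rw [ht, div_le_one hd]; linarith
  have ht' : t * (f' - f) = τ - f := by rw [ht]; field_simp
  refine ⟨(1 - t) * a + t * a', (1 - t) * b + t * b', (1 - t) * c + t * c', ?_, ?_, ?_⟩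
  · obtain ⟨h0, h1, h2, h3, h4, h5⟩ := h
    obtain ⟨g0, g1, g2, g3, g4, g5⟩ := h'
    have key : ∀ {l u x y : ℝ}, (l < x ∧ x < u) → (l < y ∧ y < u) →
        (l < (1 - t) * x + t * y ∧ (1 - t) * x + t * y < u) := fun h h' =>
      ⟨cvx_lt h.1 h'.1 t0 t1, cvx_gt h.2 h'.2 t0 t1⟩
    refine ⟨key h0 g0, key h1 g1, key h2 g2, ?_, ?_, ?_⟩
    · convert key h3 g3 using 2 <;> ring
    · convert key h4 g4 using 2 <;> ring
    · convert key h5 g5 using 2 <;> ring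
  · rw [hf, hf'] at ht'
    linear_combination ht'
  · intro A B C k k1 k2
    nlinarith [mul_nonneg t0 (sub_nonneg.2 k2), mul_nonneg (sub_nonneg.2 t1) (sub_nonneg.2 k1)]

set_option maxHeartbeats 4000000 in
theorem core (l u : Fin 6 → ℝ) (m : ℝ) (hm1 : 1 < m) (hm2 : m < 2)
    (bd : ∀ a b c, KK l u a b c → 0 < a ∧ 0 < b ∧ 0 < c ∧ a ≤ 1/2 ∧ b ≤ 1/2 ∧ b + c ≤ 1/2)
    (hz : ∃ a b c, KK l u a b c ∧ a + b + c < 1/2)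
    (hu : ∃ a b c, KK l u a b c ∧ 1/2 < a + b)
    (H0 : ∀ a b c, KK l u a b c → a + b + c < 1/2 →
      KK l u (m * a) (m * b) (m * c) ∧ 1/2 < m * (a + b))
    (H1 : ∀ a b c, KK l u a b c → a + b < 1/2 → 1/2 < a + b + c →
      KK l u (m * b) (m * (1/2 - (a + b)) + (1/2 - m/4)) (m * (a + b + c - 1/2)))
    (H2 : ∀ a b c, KK l u a b c → 1/2 < a + b →
      KK l u (m * (1/2 - a)) (m * (a + b - 1/2) + (1/2 - m/4)) (m * c)) : False := by
  obtain ⟨za, zb, zc, hz, hzs⟩ := hz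
  obtain ⟨ua, ub, uc, hu, hup⟩ := hu
  have hm0 : 0 < m := by linarith
  -- sups and infs
  obtain ⟨A, hA⟩ : ∃ A, IsLUB {t | ∃ b c, KK l u t b c} A :=
    Real.exists_isLUB ⟨za, zb, zc, hz⟩ ⟨1/2, by rintro t ⟨b, c, h⟩; exact (bd _ _ _ h).2.2.2.1⟩
  obtain ⟨B, hB⟩ : ∃ A, IsLUB {t | ∃ a c, KK l u a t c} A :=
    Real.exists_isLUB ⟨zb, za, zc, hz⟩ ⟨1/2, by rintro t ⟨b, c, h⟩; exact (bd _ _ _ h).2.2.2.2.1⟩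
  obtain ⟨al, hal⟩ : ∃ A, IsGLB {t | ∃ b c, KK l u t b c} A :=
    Real.exists_isGLB ⟨za, zb, zc, hz⟩ ⟨0, by rintro t ⟨b, c, h⟩; exact (bd _ _ _ h).1.le⟩
  obtain ⟨bl, hbl⟩ : ∃ A, IsGLB {t | ∃ a c, KK l u a t c} A :=
    Real.exists_isGLB ⟨zb, za, zc, hz⟩ ⟨0, by rintro t ⟨b, c, h⟩; exact (bd _ _ _ h).2.1.le⟩
  obtain ⟨pl, hpl⟩ : ∃ A, IsGLB {t | ∃ a b c, KK l u a b c ∧ t = a + b} A :=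
    Real.exists_isGLB ⟨za + zb, za, zb, zc, hz, rfl⟩
      ⟨0, by rintro t ⟨a, b, c, h, rfl⟩; linarith [(bd _ _ _ h).1, (bd _ _ _ h).2.1]⟩
  have A1 : ∀ {a b c}, KK l u a b c → a ≤ A := fun h => hA.1 ⟨_, _, h⟩
  have A2 : ∀ t < A, ∃ a b c, KK l u a b c ∧ t < a := fun t ht => by
    obtain ⟨x, ⟨b, c, h⟩, h', _⟩ := hA.exists_between ht; exact ⟨x, b, c, h, h'⟩
  have B1 : ∀ {a b c}, KK l u a b c → b ≤ B := fun h => hB.1 ⟨_, _, h⟩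
  have B2 : ∀ t < B, ∃ a b c, KK l u a b c ∧ t < b := fun t ht => by
    obtain ⟨x, ⟨b, c, h⟩, h', _⟩ := hB.exists_between ht; exact ⟨b, x, c, h, h'⟩
  have al1 : ∀ {a b c}, KK l u a b c → al ≤ a := fun h => hal.1 ⟨_, _, h⟩
  have bl1 : ∀ {a b c}, KK l u a b c → bl ≤ b := fun h => hbl.1 ⟨_, _, h⟩
  have pl1 : ∀ {a b c}, KK l u a b c → pl ≤ a + b := fun h => hpl.1 ⟨_, _, _, h, rfl⟩
  have A0 : 0 < A := lt_of_lt_of_le (bd _ _ _ hz).1 (A1 hz)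
  have B0 : 0 < B := lt_of_lt_of_le (bd _ _ _ hz).2.1 (B1 hz)
  have Am : A / m < A := div_lt_self A0 hm1
  have Bm : B / m < B := div_lt_self B0 hm1
  have sfact : ∀ {a b c}, KK l u a b c → A / m < a → 1/2 ≤ a + b + c := by
    intro a b c h h1
    by_contra h2
    have := A1 (H0 _ _ _ h (not_le.1 h2)).1
    rw [div_lt_iff₀ hm0] at h1
    linarith
  -- Q1
  have Q1 : 1 / (2 * m) ≤ pl := by
    apply hpl.2
    rintro t ⟨a, b, c, h, rfl⟩
    obtain ⟨x, y, w, h', h1, h2, h3⟩ := L0min h hz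
    have := (H0 _ _ _ h' (by linarith)).2
    rw [div_le_iff₀ (by positivity)]
    nlinarith
  -- Q2
  have Q2 : ∀ η > 0, ∃ a b c, KK l u a b c ∧ c < η := by
    intro η hη
    have k1 := (bd _ _ _ hz).2.2.1
    have k2 := (bd _ _ _ hu).2.2.1
    obtain ⟨τ, t1, t2⟩ : ∃ τ, 1/2 < τ ∧
        τ < min (1/2 + η / m) (min (1/2 + min zc uc) (ua + ub + uc)) := by
      apply exists_between
      have : 0 < η / m := by positivity
      have := lt_min k1 k2
      refine lt_min (by linarith) (lt_min (by linarith) (by linarith))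
    simp only [lt_min_iff] at t2
    obtain ⟨t2, t3, t4⟩ := t2
    obtain ⟨x, y, w, h, h1, h2⟩ := seg_hit hz hu 1 1 1 τ (by linarith) (by linarith)
    have h3 := h2 0 0 (-1) (-(min zc uc)) (by linarith [min_le_left zc uc])
      (by linarith [min_le_right zc uc])
    refine ⟨_, _, _, H1 _ _ _ h (by linarith) (by linarith), ?_⟩
    have : τ - 1/2 < η / m := by linarith
    rw [lt_div_iff₀ hm0] at this
    nlinarith
  -- Q3
  have Q3 : ∀ η > 0, ∃ a b c, KK l u a b c ∧ b + c < 1/2 - m/4 + η := by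
    intro η hη
    obtain ⟨ya, yb, yc, hy, hyc⟩ := Q2 (η / m) (by positivity)
    obtain ⟨a1, b1, c1, h1, h11, h12⟩ := L2min hy hu
    obtain ⟨a2, b2, c2, h2, h21, h22, h23⟩ := L3max hy hz
    have k1 := (bd _ _ _ h1).2.2.1
    have k2 := (bd _ _ _ h2).2.2.1
    obtain ⟨x, y, w, h, e1, e2⟩ := seg_hit h2 h1 1 1 (1/2) (1/2) (by linarith) (by linarith)
    have h3 := e2 0 0 1 yc (by linarith) (by linarith)
    have k3 := (bd _ _ _ h).2.2.1
    refine ⟨_, _, _, H1 _ _ _ h (by linarith) (by linarith), ?_⟩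
    have : w < η / m := by linarith
    rw [lt_div_iff₀ hm0] at this
    nlinarith
  -- Q4
  have Q4 : ∀ {a b c}, KK l u a b c → m * (1/2 - (b + c)) ≤ A := by
    intro a b c hx
    by_contra hc
    push Not at hc
    obtain ⟨va, vb, vc, hv, hva⟩ := A2 _ Am
    obtain ⟨a1, b1, c1, h1, h11, h12, h13⟩ := L1min hv hx
    have s1 := sfact h1 (by linarith)
    obtain ⟨a2, b2, c2, h2, h21, h22, h23⟩ := L3max hx hz
    obtain ⟨τ, t1, t2⟩ : ∃ τ, max (A / m + (b + c)) (a2 + b2 + c2) < τ ∧ τ < 1/2 := by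
      apply exists_between
      apply max_lt
      · have : A / m < 1/2 - (b + c) := by rw [div_lt_iff₀ hm0]; linarith
        linarith
      · linarith
    rw [max_lt_iff] at t1
    obtain ⟨x, y, w, h, e1, e2⟩ := seg_hit h2 h1 1 1 1 τ (by linarith) (by linarith)
    have h3 := e2 0 1 1 (b + c) (by linarith) (by linarith)
    have := sfact h (by linarith)
    linarith
  have Q4' : m * (m / 4) ≤ A := by
    apply le_of_forall_pos_le_add
    intro η hη
    obtain ⟨a, b, c, h, h'⟩ := Q3 (η / m) (by positivity)
    have h1 := Q4 h
    have h2 : b + c - (1/2 - m/4) < η / m := by linarith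
    rw [lt_div_iff₀ hm0] at h2
    nlinarith
  -- Q5
  have Q5 : ∀ {xa xb xc va vb vc}, KK l u xa xb xc → KK l u va vb vc →
      pl ≤ (1/2 - m/4) + m * xb ∨ pl ≤ (1/2 - m/4) + m * (1/2 - va) := by
    intro xa xb xc va vb vc hx hv
    by_contra hc
    push Not at hc
    obtain ⟨c1, c2⟩ := hc
    obtain ⟨a1, b1, c1', h1, h11, h12, h13⟩ := L1min hv hx
    by_cases hp : 1/2 < a1 + b1
    · have := pl1 (H2 _ _ _ h1 hp)
      nlinarith
    · push Not at hp
      obtain ⟨a2, b2, c2', h2, h21, h22, h23, h24⟩ := L0max hv hu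
      obtain ⟨τ, t1, t2⟩ : ∃ τ, 1/2 < τ ∧ τ < min (a2 + b2) (va + (pl - (1/2 - m/4)) / m) := by
        apply exists_between
        apply lt_min
        · linarith
        · have : 1/2 - va < (pl - (1/2 - m/4)) / m := by rw [lt_div_iff₀ hm0]; linarith
          linarith
      rw [lt_min_iff] at t2
      obtain ⟨x, y, w, h, e1, e2⟩ := seg_hit h1 h2 1 1 0 τ (by linarith) (by linarith)
      have h3 := e2 (-1) 0 0 (-va) (by linarith) (by linarith)
      have h4 := pl1 (H2 _ _ _ h (by linarith))
      have h5 : y < (pl - (1/2 - m/4)) / m := by linarith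
      rw [lt_div_iff₀ hm0] at h5
      linarith
  have Q5' : pl ≤ (1/2 - m/4) + m * bl := by
    have strict : (1/2 - m/4) + m * (1/2 - A) < pl := by
      refine lt_of_lt_of_le ?_ Q1
      rw [lt_div_iff₀ (by positivity)]
      have e1 : m * (m * (m / 4)) ≤ m * A := by nlinarith
      have e2 : m * (m * (m * (m / 4))) ≤ m * (m * A) := by nlinarith
      have e3 : 0 < (m - 1)^2 * (m^2 + 2*m + 2) := by
        have : m - 1 ≠ 0 := by linarith
        positivity
      nlinarith
    have : 1/2 - (pl - (1/2 - m/4)) / m < A := by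
      have : 1/2 - A < (pl - (1/2 - m/4)) / m := by rw [lt_div_iff₀ hm0]; linarith
      linarith
    obtain ⟨va, vb, vc, hv, hva⟩ := A2 _ this
    have hva' : 1/2 - va < (pl - (1/2 - m/4)) / m := by linarith
    rw [lt_div_iff₀ hm0] at hva'
    have : (pl - (1/2 - m/4)) / m ≤ bl := by
      apply hbl.2
      rintro t ⟨a, c, h⟩
      rw [div_le_iff₀ hm0]
      rcases Q5 h hv with h | h <;> linarith
    rw [div_le_iff₀ hm0] at this
    linarith
  -- Q6
  have Q6 : A ≤ 1/2 - al / m := by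
    apply hA.2
    rintro v ⟨vb, vc, hv⟩
    obtain ⟨a2, b2, c2', h2, h21, h22, h23, h24⟩ := L0max hv hu
    have := al1 (H2 _ _ _ h2 (by linarith))
    have : al / m ≤ 1/2 - a2 := by rw [div_le_iff₀ hm0]; linarith
    linarith
  -- Q7
  have Q7 : 1/2 - A / m ≤ al := by
    apply hal.2
    rintro xa ⟨xb, xc, hx⟩
    by_contra hc
    push Not at hc
    obtain ⟨va, vb, vc, hv, hvb⟩ := B2 _ Bm
    have T : ∀ {a b c}, KK l u a b c → 1/2 ≤ a + vb := by
      intro a b c h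
      by_contra hc
      push Not at hc
      obtain ⟨ya, yb, yc, hy, hyc⟩ := Q2 (1/2 - (a + vb)) (by linarith)
      obtain ⟨x, y, w, h, h1, h2⟩ := LN h hy hv hz hzs (by linarith)
      have := B1 (H0 _ _ _ h h2).1
      rw [div_lt_iff₀ hm0] at hvb
      nlinarith
    obtain ⟨a1, b1, c1, h1, h11, h12⟩ := L1max hx hv
    have hp1 := T h1
    obtain ⟨a2, b2, c2, h2, h21, h22, h23⟩ := L0min hx hz
    have k1 := (bd _ _ _ h1).2.2.1
    have k2 := (bd _ _ _ h2).2.2.1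
    obtain ⟨τ, t1, t2⟩ : ∃ τ, max (max (A / m + xa) (a2 + b2)) (1/2 - min c1 c2) < τ ∧ τ < 1/2 := by
      apply exists_between
      have := lt_min k1 k2
      refine max_lt (max_lt (by linarith) (by linarith)) (by linarith)
    simp only [max_lt_iff] at t1
    obtain ⟨⟨t1, t3⟩, t4⟩ := t1
    obtain ⟨x, y, w, h, e1, e2⟩ := seg_hit h2 h1 1 1 0 τ (by linarith) (by linarith)
    have h3 := e2 1 0 0 xa (by linarith) (by linarith)
    have h4 := e2 0 0 (-1) (-(min c1 c2)) (by linarith [min_le_right c1 c2])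
      (by linarith [min_le_left c1 c2])
    have h5 := A1 (H1 _ _ _ h (by linarith) (by linarith))
    have h6 : A / m < y := by linarith
    rw [div_lt_iff₀ hm0] at h6
    linarith
  have Q8 : pl < 1/2 := by linarith [pl1 hz, (bd _ _ _ hz).2.2.1]
  have Q9 : al + bl ≤ pl := by
    apply hpl.2
    rintro t ⟨a, b, c, h, rfl⟩
    linarith [al1 h, bl1 h]
  have q6 : al / m ≤ 1/2 - A := by linarith
  rw [div_le_iff₀ hm0] at q6
  have q7 : 1/2 - al ≤ A / m := by linarith
  rw [le_div_iff₀ hm0] at q7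
  -- al * (m+1) ≥ m/2
  have r1 : m / 2 ≤ al * (m + 1) := by
    have : (m - 1) * (m / 2) ≤ (m - 1) * (al * (m + 1)) := by nlinarith
    exact le_of_mul_le_mul_left this (by linarith)
  have r2 : 1/4 < al := by nlinarith
  have r3 : m * al ≤ m / 4 := by nlinarith
  nlinarith

lemma hfun_zero {u : ℝ} (h0 : -(1/2) ≤ u) (h1 : u ≤ 1/2) : hfun u = 0 := by
  unfold hfun
  split_ifs with h
  · rfl
  · have : u ≠ 1/2 := by rintro rfl; apply h; norm_num
    have : u < 1/2 := lt_of_le_of_ne h1 this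
    have : ⌊u + 1/2⌋ = 0 := by rw [Int.floor_eq_iff]; constructor <;> push_cast <;> linarith
    rw [this]; simp

lemma hfun_one {u : ℝ} (h0 : 1/2 < u) (h1 : u < 3/2) : hfun u = 1 := by
  have h : ⌊u + 1/2⌋ = 1 := by rw [Int.floor_eq_iff]; constructor <;> push_cast <;> linarith
  unfold hfun
  rw [h, if_neg]
  · simp
  · rw [Int.fract, h]; push_cast; linarith

lemma hfun_int (u : ℝ) : ∃ n : ℤ, hfun u = n := by
  unfold hfun
  split_ifs
  · exact ⟨0, by simp⟩
  · exact ⟨_, rfl⟩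

lemma le_half {u : ℝ} (h : hfun u = 0) (h1 : u < 3/2) : u ≤ 1/2 := by
  by_contra hc
  rw [hfun_one (not_le.1 hc) h1] at h
  norm_num at h

lemma mem_iff (m : CM 6) (x : Fin 3 → ℝ) :
    x ∈ PolySet alpha6 m ↔ KK m.1 m.2 (x 0) (x 1) (x 2) := by
  simp [PolySet, KK, alpha6, Matrix.mulVec, dotProduct, Fin.forall_fin_succ, Fin.sum_univ_succ,
    add_assoc]

/-- no polytope built on the canonical coefficient matrix solves
Conditioning Problem 4. -/
theorem statement_18 (ε : ℝ) (hε : ε ∈ Set.Ioo (0:ℝ) (1/2)) :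
    ¬ ∃ m : CM 6, SolvesCP4 ε (PolySet alpha6 m) := by
  rintro ⟨M, -, hcube, hat, F0, F1, F2⟩
  obtain ⟨e0, e1⟩ := hε
  have mm : ∀ {a b c : ℝ}, KK M.1 M.2 a b c ↔ ![a, b, c] ∈ PolySet alpha6 M := by
    intro a b c; rw [mem_iff]; simp
  have zz : ∀ {a b c : ℝ}, KK M.1 M.2 a b c → 0 < a ∧ a < 1 ∧ 0 < b ∧ b < 1 ∧ 0 < c ∧ c < 1 := by
    intro a b c h
    have := hcube (mm.1 h)
    have h0 := this 0
    have h1 := this 1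
    have h2 := this 2
    simp at h0 h1 h2
    exact ⟨h0.1, h0.2, h1.1, h1.2, h2.1, h2.2⟩
  have bd : ∀ a b c, KK M.1 M.2 a b c →
      0 < a ∧ 0 < b ∧ 0 < c ∧ a ≤ 1/2 ∧ b ≤ 1/2 ∧ b + c ≤ 1/2 := by
    intro a b c h
    obtain ⟨a0, a1, b0, b1, c0, c1⟩ := zz h
    obtain ⟨n0, k0⟩ := hfun_int a
    obtain ⟨n1, k1⟩ := hfun_int b
    obtain ⟨n2, k2⟩ := hfun_int c
    obtain ⟨n3, k3⟩ := hfun_int (a + b)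
    obtain ⟨n4, k4⟩ := hfun_int (b + c)
    obtain ⟨n5, k5⟩ := hfun_int (a + b + c)
    have := (hat ![n0, n1, n2, n3, n4, n5]).1 ⟨![a, b, c], mm.1 h, hcube (mm.1 h), k0, k1, k2, k3, k4, k5⟩
    have hh : n0 = 0 ∧ n1 = 0 ∧ n2 = 0 ∧ n4 = 0 := by
      rcases this with h | h | h <;>
      exact ⟨congrFun h 0, congrFun h 1, congrFun h 2, congrFun h 4⟩
    obtain ⟨rfl, rfl, rfl, rfl⟩ := hh
    norm_num at k0 k1 k2 k4
    have := le_half k0 (by linarith)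
    have := le_half k1 (by linarith)
    have := le_half k2 (by linarith)
    exact ⟨a0, b0, c0, by linarith, by linarith, le_half k4 (by linarith)⟩
  refine core M.1 M.2 (2 * (1 - ε)) (by linarith) (by linarith) bd ?_ ?_ ?_ ?_ ?_
  · obtain ⟨x, hx, hx'⟩ := (hat ![0,0,0,0,0,0]).2 (Or.inl rfl)
    have hx := (mem_iff M x).1 hx
    obtain ⟨b1, b2, b3, b4, b5, b6⟩ := bd _ _ _ hx
    have hs : hfun (x 0 + x 1 + x 2) = 0 := by simpa using hx'.2.2.2.2.2.2
    have hs := le_half hs (by linarith)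
    obtain ⟨h0, h1, h2, h3, h4, h5⟩ := hx
    obtain ⟨δ, d0, d1⟩ : ∃ δ, 0 < δ ∧ δ < min (x 2 - M.1 2)
        (min (x 1 + x 2 - M.1 4) (x 0 + x 1 + x 2 - M.1 5)) := by
      apply exists_between
      refine lt_min (by linarith) (lt_min (by linarith) (by linarith))
    simp only [lt_min_iff] at d1
    obtain ⟨d1, d2, d3⟩ := d1
    refine ⟨x 0, x 1, x 2 - δ, ⟨h0, h1, ⟨?_, ?_⟩, h3, ⟨?_, ?_⟩, ⟨?_, ?_⟩⟩, ?_⟩ <;> linarith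
  · obtain ⟨x, hx, hx'⟩ := (hat ![0,0,0,1,0,1]).2 (Or.inr (Or.inr rfl))
    have hx := (mem_iff M x).1 hx
    obtain ⟨b1, b2, b3, b4, b5, b6⟩ := bd _ _ _ hx
    have hs : hfun (x 0 + x 1) = 1 := by simpa using hx'.2.2.2.2.1
    refine ⟨_, _, _, hx, ?_⟩
    by_contra hc
    rw [hfun_zero (by linarith) (not_lt.1 hc)] at hs
    norm_num at hs
  · intro a b c h hs
    obtain ⟨b1, b2, b3, b4, b5, b6⟩ := bd _ _ _ h
    have k0 : hfun a = 0 := hfun_zero (by linarith) (by linarith)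
    have k1 : hfun b = 0 := hfun_zero (by linarith) (by linarith)
    have k2 : hfun c = 0 := hfun_zero (by linarith) (by linarith)
    have k3 : hfun (a + b) = 0 := hfun_zero (by linarith) (by linarith)
    have k4 : hfun (b + c) = 0 := hfun_zero (by linarith) (by linarith)
    have k5 : hfun (a + b + c) = 0 := hfun_zero (by linarith) (by linarith)
    have := F0 ⟨![a, b, c], ⟨mm.1 h, hcube (mm.1 h), by simp [k0], by simp [k1], by simp [k2],
      by simp [k3], by simp [k4], by simp [k5]⟩, rfl⟩
    obtain ⟨g, g'⟩ := this
    rw [mem_iff] at g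
    have hs : hfun (G3 ε ![a, b, c] 0 + G3 ε ![a, b, c] 1) = 1 := by simpa using g'.2.2.2.2.1
    simp [G3, k0, k1, k2, k3, k4, k5] at g hs
    refine ⟨g, ?_⟩
    obtain ⟨g1, g2, _⟩ := bd _ _ _ g
    by_contra hc
    rw [hfun_zero (by linarith) (by linarith)] at hs
    norm_num at hs
  · intro a b c h hp hs
    obtain ⟨b1, b2, b3, b4, b5, b6⟩ := bd _ _ _ h
    have k0 : hfun a = 0 := hfun_zero (by linarith) (by linarith)
    have k1 : hfun b = 0 := hfun_zero (by linarith) (by linarith)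
    have k2 : hfun c = 0 := hfun_zero (by linarith) (by linarith)
    have k3 : hfun (a + b) = 0 := hfun_zero (by linarith) (by linarith)
    have k4 : hfun (b + c) = 0 := hfun_zero (by linarith) (by linarith)
    have k5 : hfun (a + b + c) = 1 := hfun_one (by linarith) (by linarith)
    obtain ⟨x, hx, hxe⟩ := F1 ⟨![a, b, c], ⟨mm.1 h, hcube (mm.1 h), by simp [k0], by simp [k1],
      by simp [k2], by simp [k3], by simp [k4], by simp [k5]⟩, rfl⟩
    have hx := (mem_iff M x).1 hx
    obtain ⟨a1, a2, a3, a4, a5, a6⟩ := bd _ _ _ hx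
    have q0 := congrFun hxe 0
    have q1 := congrFun hxe 1
    have q2 := congrFun hxe 2
    simp [G3, sigma3124, frv, k0, k1, k2, k3, k4, k5] at q0 q1 q2
    rw [Int.fract_eq_self.2 ⟨by linarith, by linarith⟩] at q1 q2
    have q3 : x 0 + x 1 < 1 := by
      by_contra hc
      have : -(x 0) - x 1 = ((-1 : ℤ) : ℝ) := by push_cast; linarith
      rw [this, Int.fract_intCast] at q0
      nlinarith
    have q4 : Int.fract (-(x 0) - x 1) = 1 - (x 0 + x 1) := by
      rw [Int.fract_eq_iff]
      exact ⟨by linarith, by linarith, -1, by push_cast; ring⟩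
    rw [q4] at q0
    convert hx using 1 <;> linarith
  · intro a b c h hp
    obtain ⟨b1, b2, b3, b4, b5, b6⟩ := bd _ _ _ h
    have k0 : hfun a = 0 := hfun_zero (by linarith) (by linarith)
    have k1 : hfun b = 0 := hfun_zero (by linarith) (by linarith)
    have k2 : hfun c = 0 := hfun_zero (by linarith) (by linarith)
    have k3 : hfun (a + b) = 1 := hfun_one (by linarith) (by linarith)
    have k4 : hfun (b + c) = 0 := hfun_zero (by linarith) (by linarith)
    have k5 : hfun (a + b + c) = 1 := hfun_one (by linarith) (by linarith)
    obtain ⟨x, hx, hxe⟩ := F2 ⟨![a, b, c], ⟨mm.1 h, hcube (mm.1 h), by simp [k0], by simp [k1],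
      by simp [k2], by simp [k3], by simp [k4], by simp [k5]⟩, rfl⟩
    have hx := (mem_iff M x).1 hx
    obtain ⟨a1, a2, a3, a4, a5, a6⟩ := bd _ _ _ hx
    have q0 := congrFun hxe 0
    have q1 := congrFun hxe 1
    have q2 := congrFun hxe 2
    simp [G3, sigma2134, frv, k0, k1, k2, k3, k4, k5] at q0 q1 q2
    rw [Int.fract_eq_self.2 ⟨by linarith, by linarith⟩] at q2
    have q3 : x 0 + x 1 < 1 := by
      by_contra hc
      have : x 0 + x 1 = ((1 : ℤ) : ℝ) := by push_cast; linarith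
      rw [this, Int.fract_intCast] at q1
      nlinarith
    have q4 : Int.fract (-(x 0)) = 1 - x 0 := by
      rw [Int.fract_eq_iff]
      exact ⟨by linarith, by linarith, -1, by push_cast; ring⟩
    rw [q4] at q0
    rw [Int.fract_eq_self.2 ⟨by linarith, by linarith⟩] at q1
    convert hx using 1 <;> linarith
end
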